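/- arXiv:1907.06722 — 3 statements merged into one kernel-verified Lean document; each statement's English description precedes it below -/
import Mathlib

section
/- Let h : ℝⁿ → ℝ be continuously differentiable, let x : ℝ → ℝⁿ be a differentiable curve, and let λ > 0. Define the safety set C = {y ∈ ℝⁿ : h(y) ≥ 0}. If x(0) ∈ C and for every t ≥ 0 the derivative of t ↦ h(x(t)) satisfies (d/dt) h(x(t)) ≥ -λ·h(x(t)), then x(t) ∈ C for all t ≥ 0, i.e., the trajectory renders C forward invariant. -/
/-- If `f' ≥ -c f` on `[0, ∞)`, then `t ↦ exp (c t) f t` is monotone there. -/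
theorem monotoneOn_exp_mul_of_neg_mul_le_deriv {f : ℝ → ℝ} (hf : Differentiable ℝ f) {c : ℝ}
    (hderiv : ∀ t : ℝ, 0 ≤ t → -c * f t ≤ deriv f t) :
    MonotoneOn (fun t => Real.exp (c * t) * f t) (Set.Ici 0) := by
  have hd (t : ℝ) : HasDerivAt (fun t => Real.exp (c * t) * f t)
      (Real.exp (c * t) * (c * 1) * f t + Real.exp (c * t) * deriv f t) t :=
    (((hasDerivAt_id' t).const_mul c).exp).mul (hf t).hasDerivAt
  refine monotoneOn_of_deriv_nonneg (convex_Ici 0)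
    (fun t _ => (hd t).continuousAt.continuousWithinAt)
    (fun t _ => (hd t).differentiableAt.differentiableWithinAt) fun t ht => ?_
  rw [(hd t).deriv]
  have h0 : 0 ≤ t := interior_subset ht
  have h1 : 0 ≤ Real.exp (c * t) * (c * f t + deriv f t) :=
    mul_nonneg (Real.exp_pos _).le (by linarith [hderiv t h0])
  linarith

/-- Forward invariance of the safety set `C = {y | h y ≥ 0}` along a trajectory
satisfying the relative-degree-1 CBF condition `(d/dt) h(x(t)) ≥ -λ h(x(t))`. -/
theorem cbf_forward_invariance
    {n : ℕ} (h : (Fin n → ℝ) → ℝ) (hh : ContDiff ℝ 1 h)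
    (x : ℝ → (Fin n → ℝ)) (hx : Differentiable ℝ x)
    (lam : ℝ) (hlam : 0 < lam)
    (C : Set (Fin n → ℝ)) (hC : C = {y | h y ≥ 0})
    (hinit : x 0 ∈ C)
    (hineq : ∀ t : ℝ, 0 ≤ t → deriv (fun s => h (x s)) t ≥ -lam * h (x t)) :
    ∀ t : ℝ, 0 ≤ t → x t ∈ C := by
  subst hC
  intro t ht
  have hf : Differentiable ℝ (fun s => h (x s)) := (hh.differentiable one_ne_zero).comp hx
  have hmono := monotoneOn_exp_mul_of_neg_mul_le_deriv hf hineq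
    (Set.mem_Ici.2 le_rfl) (Set.mem_Ici.2 ht) ht
  simp only [mul_zero, Real.exp_zero, one_mul] at hmono
  exact nonneg_of_mul_nonneg_right (le_trans hinit hmono) (Real.exp_pos _)
end

section
/- Let λ₁, λ₂ > 0 and let h : ℝ → ℝ be twice differentiable on [0, ∞). Suppose h''(t) + (λ₁ + λ₂)·h'(t) + λ₁·λ₂·h(t) ≥ 0 for all t ≥ 0, and suppose h(0) ≥ 0 and h'(0) + λ₁·h(0) ≥ 0. Then h(t) ≥ 0 for all t ≥ 0. -/
/-- A function satisfying `f' + c f ≥ 0` on `[0,∞)` with `f(0) ≥ 0` is nonnegative on `[0,∞)`. -/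
theorem nonneg_of_hasDerivAt_add_mul_nonneg {c : ℝ} {f f' : ℝ → ℝ}
    (hf : ∀ t : ℝ, 0 ≤ t → HasDerivAt f (f' t) t)
    (hineq : ∀ t : ℝ, 0 ≤ t → 0 ≤ f' t + c * f t) (h0 : 0 ≤ f 0) {t : ℝ} (ht : 0 ≤ t) :
    0 ≤ f t := by
  have hd : ∀ s : ℝ, 0 ≤ s →
      HasDerivAt (fun s => Real.exp (c * s) * f s) (Real.exp (c * s) * (f' s + c * f s)) s := by
    intro s hs
    exact (((hasDerivAt_id' s).const_mul c).exp.mul (hf s hs)).congr_deriv (by ring)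
  have hmono : MonotoneOn (fun s => Real.exp (c * s) * f s) (Set.Ici 0) :=
    monotoneOn_of_hasDerivWithinAt_nonneg (convex_Ici 0)
      (fun s hs => (hd s hs).continuousAt.continuousWithinAt)
      (fun s hs => (hd s (interior_subset hs)).hasDerivWithinAt)
      (fun s hs => mul_nonneg (Real.exp_pos _).le (hineq s (interior_subset hs)))
  have hle : f 0 ≤ Real.exp (c * t) * f t := by
    simpa using hmono Set.self_mem_Ici ht ht
  exact nonneg_of_mul_nonneg_right (h0.trans hle) (Real.exp_pos _)

/-- ECBF forward-invariance theorem for relative degree 2 with gains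
`K_b = [λ₁λ₂, λ₁+λ₂]`: if `h'' + (λ₁+λ₂) h' + λ₁λ₂ h ≥ 0` on `[0,∞)`,
`h(0) ≥ 0` and `h'(0) + λ₁ h(0) ≥ 0`, then `h(t) ≥ 0` for all `t ≥ 0`. -/
theorem ecbf_degree_two_invariance
    (lam1 lam2 : ℝ) (hlam1 : 0 < lam1) (hlam2 : 0 < lam2)
    (h h' h'' : ℝ → ℝ)
    (hd1 : ∀ t : ℝ, 0 ≤ t → HasDerivAt h (h' t) t)
    (hd2 : ∀ t : ℝ, 0 ≤ t → HasDerivAt h' (h'' t) t)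
    (hineq : ∀ t : ℝ, 0 ≤ t →
      h'' t + (lam1 + lam2) * h' t + lam1 * lam2 * h t ≥ 0)
    (h0 : h 0 ≥ 0) (h0' : h' 0 + lam1 * h 0 ≥ 0) :
    ∀ t : ℝ, 0 ≤ t → h t ≥ 0 := by
  have hg : ∀ t : ℝ, 0 ≤ t → 0 ≤ h' t + lam1 * h t := fun t ht =>
    nonneg_of_hasDerivAt_add_mul_nonneg (c := lam2)
      (f := fun s => h' s + lam1 * h s) (f' := fun s => h'' s + lam1 * h' s)
      (fun s hs => (hd2 s hs).add ((hd1 s hs).const_mul lam1))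
      (fun s hs => by linarith [hineq s hs]) h0' ht
  exact fun t ht => nonneg_of_hasDerivAt_add_mul_nonneg hd1 hg h0 ht
end

section
/- Let N ≥ 1, let h₁, …, h_N : ℝⁿ → ℝ be continuously differentiable, let x : ℝ → ℝⁿ be a differentiable curve, and let λ₁, …, λ_N > 0. Define C_i = {y ∈ ℝⁿ : h_i(y) ≥ 0} and C_robot = ⋂_{i=1}^N C_i. If x(0) ∈ C_robot and for every i and every t ≥ 0 the derivative of t ↦ h_i(x(t)) satisfies (d/dt) h_i(x(t)) ≥ -λ_i·h_i(x(t)), then x(t) ∈ C_robot for all t ≥ 0. -/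
/-- If `g' ≥ -c g` on `[0, ∞)` and `g 0 ≥ 0`, then `g` is nonnegative on `[0, ∞)`. -/
theorem nonneg_of_deriv_ge_neg_mul {g : ℝ → ℝ} {c : ℝ} (hg : Differentiable ℝ g)
    (h0 : 0 ≤ g 0) (hderiv : ∀ t, 0 ≤ t → -c * g t ≤ deriv g t) {t : ℝ} (ht : 0 ≤ t) :
    0 ≤ g t := by
  have hd : ∀ s, HasDerivAt (fun s => Real.exp (c * s) * g s)
      (Real.exp (c * s) * (c * 1) * g s + Real.exp (c * s) * deriv g s) s := fun s =>
    (((hasDerivAt_id s).const_mul c).exp).mul (hg s).hasDerivAt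
  have hmono : MonotoneOn (fun s => Real.exp (c * s) * g s) (Set.Ici 0) := by
    refine monotoneOn_of_deriv_nonneg (convex_Ici 0)
      (fun s _ => (hd s).continuousAt.continuousWithinAt)
      (fun s _ => (hd s).differentiableAt.differentiableWithinAt) fun s hs => ?_
    rw [(hd s).deriv]
    have hpos := mul_nonneg (Real.exp_pos (c * s)).le
      (sub_nonneg.2 (hderiv s (interior_subset hs)))
    linarith
  have hle := hmono Set.self_mem_Ici ht ht
  simp only [mul_zero, Real.exp_zero, one_mul] at hle
  exact nonneg_of_mul_nonneg_right (h0.trans hle) (Real.exp_pos _)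

/-- Forward invariance of the intersection `C_robot = ⋂ i, C i` of `N ≥ 1` safety
sets, when each barrier satisfies its CBF condition along the trajectory. -/
theorem cbf_intersection_forward_invariance
    {n : ℕ} (N : ℕ) (hN : 1 ≤ N)
    (h : Fin N → (Fin n → ℝ) → ℝ) (hh : ∀ i, ContDiff ℝ 1 (h i))
    (x : ℝ → (Fin n → ℝ)) (hx : Differentiable ℝ x)
    (lam : Fin N → ℝ) (hlam : ∀ i, 0 < lam i)
    (C : Fin N → Set (Fin n → ℝ)) (hC : ∀ i, C i = {y | h i y ≥ 0})
    (Crobot : Set (Fin n → ℝ)) (hCrobot : Crobot = ⋂ i, C i)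
    (hinit : x 0 ∈ Crobot)
    (hineq : ∀ i, ∀ t : ℝ, 0 ≤ t →
      deriv (fun s => h i (x s)) t ≥ -lam i * h i (x t)) :
    ∀ t : ℝ, 0 ≤ t → x t ∈ Crobot := by
  subst hCrobot
  simp only [hC, Set.mem_iInter, Set.mem_ofPred_eq, ge_iff_le] at hinit ⊢
  intro t ht i
  exact nonneg_of_deriv_ge_neg_mul (((hh i).differentiable one_ne_zero).comp hx)
    (hinit i) (hineq i) ht
end
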